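/- arXiv:2209.14580 — 2 statements merged into one kernel-verified Lean document; each statement's English description precedes it below -/
import Mathlib

section
/- Let p(a) be a free polynomial with complex scalar coefficients in the freely noncommuting variables a_1,…,a_μ of degree at most m ≥ 0, and let N(μ,m) = Σ_{j=0}^m μ^j. If there exist an integer n ≥ N(μ,m) and a nonempty open subset U of S_n(ℂ^μ) (with its natural topology as a finite-dimensional real vector space) such that p(A) = 0 for every A ∈ U, then p is the zero polynomial. -/
open Matrix

/-- Evaluation of a scalar free polynomial in the variables `a₁, …, a_μ` at a `μ`-tuple of
`n × n` matrices. -/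
noncomputable def scalarPolyEval {μ : ℕ} {k : Type*} [Fintype k] [DecidableEq k]
    (p : FreeMonoid (Fin μ) →₀ ℂ) (A : Fin μ → Matrix k k ℂ) : Matrix k k ℂ :=
  p.sum fun w c => c • (w.toList.map A).prod

open Polynomial in
/-- If a free polynomial vanishes at infinitely many complex points of the affine line
`A + z B`, then it vanishes on the whole line. -/
theorem scalarPolyEval_line_eq_zero {μ : ℕ} {k : Type*} [Fintype k] [DecidableEq k]
    (p : FreeMonoid (Fin μ) →₀ ℂ) (A B : Fin μ → Matrix k k ℂ) {S : Set ℂ} (hS : S.Infinite)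
    (h : ∀ z ∈ S, scalarPolyEval p (A + z • B) = 0) (z : ℂ) :
    scalarPolyEval p (A + z • B) = 0 := by
  let Q : Fin μ → Matrix k k ℂ[X] := fun i => (A i).map C + (X : ℂ[X]) • (B i).map C
  let M : Matrix k k ℂ[X] := p.sum fun w c => C c • (w.toList.map Q).prod
  have hQ : ∀ z : ℂ, ∀ i, (evalRingHom z).mapMatrix (Q i) = (A + z • B) i := by
    intro z i
    ext j l
    simp [Q, mul_comm (B i j l)]
  have hM : ∀ z : ℂ, (evalRingHom z).mapMatrix M = scalarPolyEval p (A + z • B) := by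
    intro z
    simp only [M, scalarPolyEval, Finsupp.sum, map_sum]
    refine Finset.sum_congr rfl fun w _ => ?_
    have hw : (evalRingHom z).mapMatrix (w.toList.map Q).prod
        = (w.toList.map (A + z • B)).prod := by
      rw [map_list_prod, List.map_map]
      congr 1
      exact List.map_congr_left fun i _ => hQ z i
    rw [← hw]
    ext j l
    simp
  have hM0 : M = 0 := by
    ext1 j l
    refine eq_zero_of_infinite_isRoot _ (hS.mono fun y hy => ?_)
    have := congrFun (congrFun ((hM y).trans (h y hy)) j) l
    simpa using this
  rw [← hM, hM0, map_zero]

/-- The shift matrices along the word `w`: the `i`-th one maps position `j + 1` to position `j`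
exactly when the letter of `w` at position `j` is `i`. -/
def wordShift {α : Type*} [DecidableEq α] (n : ℕ) (w : List α) (i : α) :
    Matrix (Fin n) (Fin n) ℂ :=
  Matrix.of fun j l => if (l : ℕ) = j + 1 ∧ w[(j : ℕ)]? = some i then 1 else 0

theorem prod_map_wordShift_apply {α : Type*} [DecidableEq α] {n : ℕ} (w v : List α)
    (j l : Fin n) :
    (v.map (wordShift n w)).prod j l
      = if (l : ℕ) = j + v.length ∧ v <+: w.drop j then 1 else 0 := by
  induction v generalizing j with
  | nil => simp [Matrix.one_apply, Fin.ext_iff, eq_comm]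
  | cons i v ih =>
    have hpre : i :: v <+: w.drop j ↔ w[(j : ℕ)]? = some i ∧ v <+: w.drop (j + 1) := by
      rcases lt_or_ge (j : ℕ) w.length with hj | hj
      · rw [List.drop_eq_getElem_cons hj, List.cons_prefix_cons, List.getElem?_eq_getElem hj]
        simp [eq_comm]
      · simp [List.drop_eq_nil_of_le hj, hj]
    rw [List.map_cons, List.prod_cons, Matrix.mul_apply]
    simp only [ih, hpre, List.length_cons]
    by_cases hj : (j : ℕ) + 1 < n
    · rw [Finset.sum_eq_single (⟨j + 1, hj⟩ : Fin n)]
      · simp only [wordShift, Matrix.of_apply, true_and, ite_mul, one_mul, zero_mul]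
        rw [show (j : ℕ) + 1 + v.length = j + (v.length + 1) by omega, ← ite_and]
        exact if_congr (by tauto) rfl rfl
      · intro b _ hb
        have : ¬ (b : ℕ) = j + 1 := fun h => hb (Fin.ext h)
        simp [wordShift, this]
      · simp
    · rw [if_neg (by omega)]
      refine Finset.sum_eq_zero fun b _ => ?_
      have : ¬ (b : ℕ) = j + 1 := by omega
      simp [wordShift, this]

/-- A free polynomial vanishing at all tuples of `n × n` matrices has no nonzero coefficient on
words of length less than `n`. -/
theorem coeff_eq_zero_of_scalarPolyEval_eq_zero {μ n : ℕ} (p : FreeMonoid (Fin μ) →₀ ℂ)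
    (h : ∀ A : Fin μ → Matrix (Fin n) (Fin n) ℂ, scalarPolyEval p A = 0)
    (w : FreeMonoid (Fin μ)) (hw : w.toList.length < n) : p w = 0 := by
  have h0 := congrFun (congrFun (h (wordShift n w.toList)) ⟨0, by omega⟩) ⟨w.toList.length, hw⟩
  have hne : ∀ v : FreeMonoid (Fin μ), v ≠ w →
      ¬ (w.toList.length = v.toList.length ∧ v.toList <+: w.toList) :=
    fun v hvw hv => hvw (FreeMonoid.toList.injective (hv.2.eq_of_length hv.1.symm))
  simp only [scalarPolyEval, Finsupp.sum, Matrix.sum_apply, Matrix.smul_apply,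
    prod_map_wordShift_apply, zero_add, List.drop_zero, Matrix.zero_apply] at h0
  rw [Finset.sum_eq_single w (fun v _ hvw => by rw [if_neg (hne v hvw), smul_zero])
    (fun hw0 => by rw [Finsupp.notMem_support_iff.mp hw0, zero_smul])] at h0
  simpa using h0

/-- A free polynomial vanishing on a nonempty open set of hermitian tuples vanishes at every
hermitian tuple. -/
theorem scalarPolyEval_eq_zero_of_isHermitian {μ : ℕ} {k : Type*} [Fintype k] [DecidableEq k]
    (p : FreeMonoid (Fin μ) →₀ ℂ)
    (U : Set {A : Fin μ → Matrix k k ℂ // ∀ i, (A i).IsHermitian})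
    (hUopen : IsOpen U) (hUne : U.Nonempty) (hvanish : ∀ A ∈ U, scalarPolyEval p A.val = 0)
    (B : Fin μ → Matrix k k ℂ) (hB : ∀ i, (B i).IsHermitian) : scalarPolyEval p B = 0 := by
  obtain ⟨A, hA⟩ := hUne
  let γ : ℝ → {A : Fin μ → Matrix k k ℂ // ∀ i, (A i).IsHermitian} := fun t =>
    ⟨A.val + (t : ℂ) • (B - A.val), fun i =>
      (A.2 i).add (((hB i).sub (A.2 i)).smul (Complex.conj_ofReal t))⟩
  have hγ : Continuous γ := by
    refine Continuous.subtype_mk ?_ _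
    fun_prop
  have hmem : γ ⁻¹' U ∈ nhds (0 : ℝ) := by
    refine (hUopen.preimage hγ).mem_nhds ?_
    have h0 : γ 0 = A := by
      ext1
      simp [γ]
    simpa [h0] using hA
  have hinf : ((fun t : ℝ => (t : ℂ)) '' (γ ⁻¹' U)).Infinite :=
    (infinite_of_mem_nhds 0 hmem).image Complex.ofReal_injective.injOn
  have := scalarPolyEval_line_eq_zero p A.val (B - A.val) hinf
    (by rintro _ ⟨t, ht, rfl⟩; exact hvanish _ ht) 1
  simpa using this

open ComplexStarModule in
/-- A free polynomial vanishing at all hermitian tuples vanishes at all tuples. -/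
theorem scalarPolyEval_eq_zero_of_forall_isHermitian {μ : ℕ} {k : Type*} [Fintype k]
    [DecidableEq k] (p : FreeMonoid (Fin μ) →₀ ℂ)
    (h : ∀ A : Fin μ → Matrix k k ℂ, (∀ i, (A i).IsHermitian) → scalarPolyEval p A = 0)
    (A : Fin μ → Matrix k k ℂ) : scalarPolyEval p A = 0 := by
  have hA : A = (fun i => (ℜ (A i) : Matrix k k ℂ))
      + Complex.I • (fun i => (ℑ (A i) : Matrix k k ℂ)) := by
    ext1 i
    exact (realPart_add_I_smul_imaginaryPart (A i)).symm
  rw [hA]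
  refine scalarPolyEval_line_eq_zero p _ _
    (Set.infinite_range_of_injective Complex.ofReal_injective) ?_ Complex.I
  rintro _ ⟨t, rfl⟩
  exact h _ fun i => Matrix.IsHermitian.add (ℜ (A i)).2
    (Matrix.IsHermitian.smul (ℑ (A i)).2 (Complex.conj_ofReal t))

/-- a variant of the Amitsur–Levitzki theorem. If a scalar free
polynomial `p(a)` of degree at most `m` vanishes on a nonempty open subset of
`S_n(ℂ^μ)` for some `n ≥ N(μ,m) = Σ_{j=0}^m μ^j`, then `p = 0`. -/
theorem vanishing_on_open_set_implies_zero {μ m : ℕ} (hμ : 0 < μ)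
    (p : FreeMonoid (Fin μ) →₀ ℂ) (hdeg : ∀ w, p w ≠ 0 → w.toList.length ≤ m)
    (n : ℕ) (hn : ∑ j ∈ Finset.range (m + 1), μ ^ j ≤ n)
    (U : Set {A : Fin μ → Matrix (Fin n) (Fin n) ℂ // ∀ i, (A i).IsHermitian})
    (hUopen : IsOpen U) (hUne : U.Nonempty)
    (hvanish : ∀ A ∈ U, scalarPolyEval p (A : {A : Fin μ → Matrix (Fin n) (Fin n) ℂ // ∀ i, (A i).IsHermitian}).val = 0) :
    p = 0 := by
  ext w
  by_contra hw
  refine hw (coeff_eq_zero_of_scalarPolyEval_eq_zero p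
    (scalarPolyEval_eq_zero_of_forall_isHermitian p
      (scalarPolyEval_eq_zero_of_isHermitian p U hUopen hUne hvanish)) w ?_)
  have hcard : m + 1 ≤ ∑ j ∈ Finset.range (m + 1), μ ^ j := by
    simpa using Finset.card_nsmul_le_sum (Finset.range (m + 1)) (fun j => μ ^ j) 1
      fun j _ => Nat.one_le_pow _ _ hμ
  have := hdeg w hw
  omega
end

section
/- For each positive integer κ and each integer n ≥ N = Σ_{j=0}^κ μ^j, there exist a tuple A ∈ S_n(ℂ^μ) and a vector v ∈ ℂ^n such that the set M_{A,v,κ} = { w(A)v : w a word in a_1,…,a_μ of length at most κ } is linearly independent in ℂ^n. In particular, when κ = 1 there exist A ∈ S_{μ+1}(ℂ^μ) and v ∈ ℂ^{μ+1} such that {v, A_1 v, …, A_μ v} is linearly independent. -/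
open Matrix

/-- Evaluation of a word in the variables `a₁, …, a_μ` at a `μ`-tuple of square matrices;
the empty word evaluates to the identity. -/
noncomputable def aWordEval {μ : ℕ} {k : Type*} [Fintype k] [DecidableEq k]
    (A : Fin μ → Matrix k k ℂ) (w : FreeMonoid (Fin μ)) : Matrix k k ℂ :=
  (w.toList.map A).prod

/-- Evaluating a word with a first letter is multiplication by that letter's matrix. -/
lemma aWordEval_of_mul {μ : ℕ} {k : Type*} [Fintype k] [DecidableEq k]
    (A : Fin μ → Matrix k k ℂ) (i : Fin μ) (t : FreeMonoid (Fin μ)) :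
    aWordEval A (FreeMonoid.of i * t) = A i * aWordEval A t := by
  simp [aWordEval]

/-- The words of length at most `κ` inject into any `Fin n` with `n` at least their number. -/
lemma exists_injective_boundedWords_fin {μ κ n : ℕ}
    (h : ∑ j ∈ Finset.range (κ + 1), μ ^ j ≤ n) :
    ∃ e : {w : FreeMonoid (Fin μ) // w.toList.length ≤ κ} → Fin n, Function.Injective e := by
  let f : {w : FreeMonoid (Fin μ) // w.toList.length ≤ κ} →
      Σ j : Fin (κ + 1), List.Vector (Fin μ) j :=
    fun w => ⟨⟨w.1.toList.length, Nat.lt_succ_of_le w.2⟩, ⟨w.1.toList, rfl⟩⟩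
  have hf : Function.Injective f := by
    intro w w' hw
    have := congrArg
      (fun s : Σ j : Fin (κ + 1), List.Vector (Fin μ) j => FreeMonoid.ofList s.2.toList) hw
    exact Subtype.ext this
  have hcard : Fintype.card (Σ j : Fin (κ + 1), List.Vector (Fin μ) j) ≤
      Fintype.card (Fin n) := by
    simpa [Fintype.card_sigma, card_vector, Finset.sum_range] using h
  obtain ⟨g⟩ := Function.Embedding.nonempty_of_card_le hcard
  exact ⟨g ∘ f, g.injective.comp hf⟩

open Classical in
/-- The adjacency matrix of the edges `t — i t` in the tree of words of length at most `κ`, whose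
vertices are placed in `Fin n` by `e`. -/
noncomputable def wordTreeMatrix {μ κ n : ℕ}
    (e : {w : FreeMonoid (Fin μ) // w.toList.length ≤ κ} → Fin n) (i : Fin μ) :
    Matrix (Fin n) (Fin n) ℂ :=
  fun p q => if ∃ s t, s.1 = FreeMonoid.of i * t.1 ∧
    ((p = e s ∧ q = e t) ∨ (p = e t ∧ q = e s)) then 1 else 0

lemma wordTreeMatrix_isHermitian {μ κ n : ℕ}
    (e : {w : FreeMonoid (Fin μ) // w.toList.length ≤ κ} → Fin n) (i : Fin μ) :
    (wordTreeMatrix e i).IsHermitian := by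
  ext p q
  simp only [wordTreeMatrix, Matrix.conjTranspose_apply, apply_ite star, star_one, star_zero]
  congr 1
  refine propext (exists_congr fun s => exists_congr fun t => and_congr_right fun _ => ?_)
  tauto

open Classical in
/-- Modulo shorter words, the word `w` applied to the root of the tree is the vertex `w`. -/
lemma aWordEval_wordTreeMatrix_mulVec_apply {μ κ n : ℕ}
    {e : {w : FreeMonoid (Fin μ) // w.toList.length ≤ κ} → Fin n} (he : Function.Injective e)
    (w u : {w : FreeMonoid (Fin μ) // w.toList.length ≤ κ})
    (hwu : w.1.toList.length ≤ u.1.toList.length) :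
    (aWordEval (wordTreeMatrix e) w.1 *ᵥ Pi.single (e ⟨1, Nat.zero_le κ⟩) 1) (e u) =
      if u = w then 1 else 0 := by
  obtain ⟨w, hw⟩ := w
  induction w using FreeMonoid.inductionOn' generalizing u with
  | one => simp [aWordEval, Matrix.one_apply, he.eq_iff]
  | of_mul i t ih =>
    have hlen : ∀ (j : Fin μ) (s : FreeMonoid (Fin μ)),
        (FreeMonoid.of j * s).toList.length = s.toList.length + 1 := by
      intro j s; simp
    simp only [hlen] at hwu
    have ht : t.toList.length ≤ κ := by rw [hlen] at hw; omega
    rw [aWordEval_of_mul, ← Matrix.mulVec_mulVec, Matrix.mulVec, dotProduct,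
      Finset.sum_eq_single (e ⟨t, ht⟩), ih ⟨t, ht⟩ ht le_rfl, if_pos rfl, mul_one, wordTreeMatrix]
    · congr 1
      refine propext ⟨?_, fun h => ⟨u, ⟨t, ht⟩, by rw [h], Or.inl ⟨rfl, rfl⟩⟩⟩
      rintro ⟨s, r, hsr, ⟨h₁, h₂⟩ | ⟨h₁, h₂⟩⟩
      · obtain rfl := he h₁
        obtain rfl := he h₂
        exact Subtype.ext hsr
      · obtain rfl := he h₁
        obtain rfl := he h₂
        replace hsr := congrArg (fun x => x.toList.length) hsr
        simp only [hlen] at hsr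
        omega
    · intro q _ hq
      rw [wordTreeMatrix]
      split_ifs with h
      · obtain ⟨s, r, hsr, ⟨h₁, rfl⟩ | ⟨h₁, rfl⟩⟩ := h <;> obtain rfl := he h₁ <;>
          replace hsr := congrArg (fun x => x.toList.length) hsr <;> simp only [hlen] at hsr
        · rw [ih r ht (by dsimp only; omega), if_neg (fun h => hq (congrArg e h)), mul_zero]
        · rw [ih s ht (by dsimp only; omega), if_neg (fun h => hq (congrArg e h)), mul_zero]
      · rw [zero_mul]
    · simp

/-- A family of functions that is unitriangular with respect to a degree is linearly independent. -/
lemma linearIndependent_of_unitriangular {R ι k : Type*} [Ring R] [DecidableEq ι]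
    (d : ι → ℕ) (e : ι → k) (f : ι → k → R)
    (h : ∀ i j, d i ≤ d j → f i (e j) = if j = i then 1 else 0) :
    LinearIndependent R f := by
  classical
  rw [linearIndependent_iff']
  intro s g hg
  by_contra! hne
  have hs : (s.filter (g · ≠ 0)).Nonempty := by
    obtain ⟨i, hi, hi0⟩ := hne
    exact ⟨i, by simp [hi, hi0]⟩
  obtain ⟨j, hj, hmax⟩ := Finset.exists_max_image _ d hs
  rw [Finset.mem_filter] at hj
  have key := congrFun hg (e j)
  rw [Finset.sum_apply, Finset.sum_eq_single j] at key
  · exact hj.2 (by simpa [h j j le_rfl] using key)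
  · intro i hi hij
    by_cases hi0 : g i = 0
    · simp [hi0]
    · simp [h i j (hmax i (by simp [hi, hi0])), hij.symm]
  · exact fun hjs => absurd hj.1 hjs

/-- For each `κ ≥ 1` and each `n ≥ N = Σ_{j=0}^κ μ^j` there exist a
hermitian tuple `A ∈ S_n(ℂ^μ)` and a vector `v ∈ ℂⁿ` such that the family
`{w(A)v : w a word of length at most κ}` is linearly independent.  In particular, for
`κ = 1` there are `A ∈ S_{μ+1}(ℂ^μ)` and `v ∈ ℂ^{μ+1}` with `{v, A₁v, …, A_μv}`
linearly independent. -/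
theorem exists_tuple_with_independent_orbit {μ : ℕ} (hμ : 0 < μ) :
    (∀ (κ : ℕ), 0 < κ → ∀ (n : ℕ), ∑ j ∈ Finset.range (κ + 1), μ ^ j ≤ n →
      ∃ A : Fin μ → Matrix (Fin n) (Fin n) ℂ, (∀ i, (A i).IsHermitian) ∧
        ∃ v : Fin n → ℂ,
          LinearIndependent ℂ
            (fun w : {w : FreeMonoid (Fin μ) // w.toList.length ≤ κ} =>
              (aWordEval A w.val).mulVec v)) ∧
    (∃ A : Fin μ → Matrix (Fin (μ + 1)) (Fin (μ + 1)) ℂ, (∀ i, (A i).IsHermitian) ∧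
      ∃ v : Fin (μ + 1) → ℂ,
        LinearIndependent ℂ (Fin.cons v (fun i => (A i).mulVec v) : Fin (μ + 1) → Fin (μ + 1) → ℂ)) := by
  classical
  have main : ∀ (κ n : ℕ), ∑ j ∈ Finset.range (κ + 1), μ ^ j ≤ n →
      ∃ A : Fin μ → Matrix (Fin n) (Fin n) ℂ, (∀ i, (A i).IsHermitian) ∧
        ∃ v : Fin n → ℂ,
          LinearIndependent ℂ
            (fun w : {w : FreeMonoid (Fin μ) // w.toList.length ≤ κ} =>
              (aWordEval A w.val).mulVec v) := by
    intro κ n hn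
    obtain ⟨e, he⟩ := exists_injective_boundedWords_fin hn
    exact ⟨wordTreeMatrix e, wordTreeMatrix_isHermitian e, _,
      linearIndependent_of_unitriangular (fun w => w.1.toList.length) e _
        (aWordEval_wordTreeMatrix_mulVec_apply he)⟩
  refine ⟨fun κ _ n hn => main κ n hn, ?_⟩
  obtain ⟨A, hA, v, hv⟩ := main 1 (μ + 1) (by simp [Finset.sum_range_succ, add_comm])
  refine ⟨A, hA, v, ?_⟩
  let f : Fin (μ + 1) → {w : FreeMonoid (Fin μ) // w.toList.length ≤ 1} :=
    Fin.cons ⟨1, Nat.zero_le 1⟩ fun i => ⟨FreeMonoid.of i, le_rfl⟩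
  have hf : Function.Injective f := by
    refine Fin.cons_injective_iff.2 ⟨?_, ?_⟩
    · rintro ⟨i, hi⟩
      exact FreeMonoid.of_ne_one i (congrArg Subtype.val hi)
    · exact fun i j hij => FreeMonoid.of_injective (congrArg Subtype.val hij)
  convert hv.comp f hf using 1
  funext i
  refine Fin.cases ?_ (fun i => ?_) i <;> simp [f, aWordEval]
end
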